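/- Failure of the reverse isochoric inequality without convexity (counterexample of Section 5.1, area constraint): Let r > 0 and let x₁, x₂ ∈ ℝ² with |x₁ − x₂| > 2r, so that Ω := B_r(x₁) ∪ B_r(x₂) is the union of two open disks of radius r with disjoint closures. Let B_{R₂} be an open disk of radius R₂ = √2·r, so that |B_{R₂}| = |Ω|. Then there exists α₀ < 0 such that for every α < α₀ one has the reverse strict inequality λ₁^α(B_{R₂}^ext) < λ₁^α(Ω^ext). -/

import Mathlib

open MeasureTheory Metric Set Bornology Real Filter

noncomputable section

/-- The Euclidean plane. -/
abbrev E2 := EuclideanSpace ℝ (Fin 2)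

/-- The exterior of a set: complement of its closure. -/
def extDom (Ω : Set E2) : Set E2 := (closure Ω)ᶜ

/-- The lowest Robin eigenvalue of the exterior of `Ω`, defined variationally as the
infimum of Rayleigh quotients over smooth compactly supported test functions that are
not identically zero on the exterior. -/
def robinEig (α : ℝ) (Ω : Set E2) : ℝ :=
  sInf { q : ℝ | ∃ u : E2 → ℝ, ContDiff ℝ (⊤ : ℕ∞) u ∧ HasCompactSupport u ∧
    (∃ x ∈ extDom Ω, u x ≠ 0) ∧
    q = ((∫ x in extDom Ω, ‖fderiv ℝ u x‖ ^ 2) +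
          α * ∫ x in frontier Ω, (u x) ^ 2 ∂(μH[1])) /
        (∫ x in extDom Ω, (u x) ^ 2) }

/-- A planar set has smooth boundary if its topological boundary is the image of a
smooth, periodic, regular, injective (on one period) closed curve. -/
def HasSmoothBoundary (Ω : Set E2) : Prop :=
  ∃ γ : ℝ → E2, ContDiff ℝ (⊤ : ℕ∞) γ ∧ (∀ t, γ (t + 1) = γ t) ∧
    (∀ t, deriv γ t ≠ 0) ∧ InjOn γ (Ico 0 1) ∧ range γ = frontier Ω

open scoped Pointwise

/-- The unit vector with polar angle `θ`. -/
def angleVec (θ : ℝ) : E2 := !₂[cos θ, sin θ]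

theorem continuous_angleVec : Continuous angleVec := by
  unfold angleVec
  refine (PiLp.continuous_toLp 2 _).comp (continuous_pi fun i => ?_)
  fin_cases i
  · exact continuous_cos
  · exact continuous_sin

theorem norm_angleVec (θ : ℝ) : ‖angleVec θ‖ = 1 := by
  simp [angleVec, EuclideanSpace.norm_eq, Fin.sum_univ_two]

/-- The standard isometry between the complex plane and the Euclidean plane. -/
def complexToPlane : ℂ ≃ₗᵢ[ℝ] E2 := Complex.orthonormalBasisOneI.repr

theorem complexToPlane_apply (z : ℂ) : complexToPlane z = !₂[z.re, z.im] := by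
  ext i
  fin_cases i <;> simp [complexToPlane, Complex.orthonormalBasisOneI_repr_apply]

theorem complexToPlane_exp (θ : ℝ) : complexToPlane (Circle.exp θ : ℂ) = angleVec θ := by
  rw [complexToPlane_apply, Circle.coe_exp, angleVec, Complex.exp_ofReal_mul_I_re,
    Complex.exp_ofReal_mul_I_im]

instance fact_two_pi_pos : Fact (0 < 2 * π) := ⟨two_pi_pos⟩

/-- The unit circle in the plane, parametrised by the additive circle. -/
def circleEmb (t : AddCircle (2 * π)) : E2 := complexToPlane (t.toCircle : ℂ)

theorem circleEmb_coe (θ : ℝ) : circleEmb (θ : AddCircle (2 * π)) = angleVec θ := by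
  rw [circleEmb, AddCircle.toCircle_apply_mk, ← complexToPlane_exp]
  congr 3
  field_simp

theorem measurableEmbedding_circleEmb : MeasurableEmbedding circleEmb := by
  refine Continuous.measurableEmbedding ?_ ?_
  · exact complexToPlane.continuous.comp (continuous_subtype_val.comp AddCircle.continuous_toCircle)
  · intro s t h
    exact AddCircle.injective_toCircle two_pi_pos.ne'
      (Subtype.ext (complexToPlane.injective h))

theorem range_circleEmb : range circleEmb = sphere 0 1 := by
  ext x
  constructor
  · rintro ⟨t, rfl⟩
    simp [circleEmb, Circle.norm_coe]
  · intro hx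
    have h : ‖complexToPlane.symm x‖ = 1 := by simpa using hx
    obtain ⟨t, ht⟩ := (AddCircle.homeomorphCircle two_pi_pos.ne').surjective
      ⟨complexToPlane.symm x, mem_sphere_zero_iff_norm.2 h⟩
    refine ⟨t, ?_⟩
    rw [AddCircle.homeomorphCircle_apply] at ht
    simp [circleEmb, ht]

theorem hausdorffMeasure_unitSphere_lt_top : μH[1] (sphere (0 : E2) 1) < ⊤ := by
  have h : sphere (0 : E2) 1 ⊆ (fun θ : ℝ => complexToPlane (Circle.exp θ)) '' Icc (-π) π := by
    intro x hx
    have h : ‖complexToPlane.symm x‖ = 1 := by simpa using hx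
    refine ⟨(complexToPlane.symm x).arg, ⟨(Complex.neg_pi_lt_arg _).le, Complex.arg_le_pi _⟩, ?_⟩
    have := Complex.norm_mul_exp_arg_mul_I (complexToPlane.symm x)
    rw [h] at this
    simp only [Circle.coe_exp]
    rw [show Complex.exp ((complexToPlane.symm x).arg * Complex.I) = complexToPlane.symm x by
      simpa using this]
    simp
  have hL : LipschitzWith 1 (fun θ : ℝ => complexToPlane (Circle.exp θ)) := by
    suffices h : LipschitzWith 1 (fun θ : ℝ => (Circle.exp θ : ℂ)) by
      have h' := complexToPlane.lipschitz.comp h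
      rw [one_mul] at h'
      exact h'
    refine lipschitzWith_of_nnnorm_deriv_le (C := 1) ?_ ?_
    · intro θ
      simp only [Circle.coe_exp]
      fun_prop
    · intro θ
      simp only [Circle.coe_exp]
      have : HasDerivAt (fun θ : ℝ => Complex.exp (θ * Complex.I))
          (Complex.exp (θ * Complex.I) * (1 * Complex.I)) θ :=
        ((Complex.ofRealCLM.hasDerivAt).mul_const Complex.I).cexp
      rw [this.deriv, ← NNReal.coe_le_coe]
      simp
  refine (measure_mono h).trans_lt ((hL.hausdorffMeasure_image_le zero_le_one _).trans_lt ?_)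
  rw [hausdorffMeasure_real]
  simp

theorem hausdorffMeasure_unitSphere_pos : 0 < μH[1] (sphere (0 : E2) 1) := by
  have hL : LipschitzWith 1 (fun x : E2 => x 0) := by
    refine LipschitzWith.of_dist_le_mul fun x y => ?_
    simpa [dist_eq_norm] using PiLp.norm_apply_le (x - y) 0
  have h : Icc (-1 : ℝ) 1 ⊆ (fun x : E2 => x 0) '' sphere (0 : E2) 1 := by
    intro t ht
    refine ⟨angleVec (arccos t), by simp [norm_angleVec], ?_⟩
    simp [angleVec, cos_arccos ht.1 ht.2]
  have h2 := (measure_mono h).trans (hL.hausdorffMeasure_image_le zero_le_one _)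
  rw [hausdorffMeasure_real] at h2
  refine lt_of_lt_of_le ?_ (h2.trans (by simp))
  simp

theorem isAddLeftInvariant_comap_circleEmb :
    (Measure.comap circleEmb μH[1]).IsAddLeftInvariant := by
  refine ⟨fun a => ?_⟩
  ext s hs
  have hm : Measurable fun t : AddCircle (2 * π) => a + t := measurable_const_add a
  rw [Measure.map_apply hm hs, measurableEmbedding_circleEmb.comap_apply,
    measurableEmbedding_circleEmb.comap_apply]
  set ρ : E2 ≃ₗᵢ[ℝ] E2 :=
    (complexToPlane.symm.trans (rotation a.toCircle)).trans complexToPlane with hρ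
  have h : ∀ t, ρ (circleEmb t) = circleEmb (a + t) := by
    intro t
    simp [hρ, circleEmb, AddCircle.toCircle_add]
  rw [← ρ.toIsometryEquiv.hausdorffMeasure_image 1 (circleEmb '' _)]
  congr 1
  ext x
  constructor
  · rintro ⟨_, ⟨t, ht, rfl⟩, rfl⟩
    exact ⟨a + t, ht, (h t).symm⟩
  · rintro ⟨t, ht, rfl⟩
    refine ⟨circleEmb (-a + t), ⟨-a + t, by simpa using ht, rfl⟩, ?_⟩
    exact (h _).trans (by simp)

theorem exists_restrict_unitSphere_eq_map : ∃ κ : NNReal, 0 < κ ∧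
    (μH[1] : Measure E2).restrict (sphere 0 1) =
      κ • Measure.map angleVec (volume.restrict (Ioc (-π) π)) := by
  have := isAddLeftInvariant_comap_circleEmb
  have hmap : Measure.map circleEmb (Measure.comap circleEmb μH[1]) =
      (μH[1] : Measure E2).restrict (sphere 0 1) := by
    rw [measurableEmbedding_circleEmb.map_comap, range_circleEmb]
  have : IsFiniteMeasure (Measure.comap circleEmb μH[1]) := by
    refine ⟨?_⟩
    rw [measurableEmbedding_circleEmb.comap_apply, image_univ, range_circleEmb]
    exact hausdorffMeasure_unitSphere_lt_top
  have hk := Measure.isAddInvariant_eq_smul_of_compactSpace (Measure.comap circleEmb μH[1]) volume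
  set κ := Measure.addHaarScalarFactor (Measure.comap circleEmb μH[1]) volume
  have hang : Measure.map angleVec (volume.restrict (Ioc (-π) π)) =
      Measure.map circleEmb volume := by
    rw [← (AddCircle.measurePreserving_mk (2 * π) (-π)).map_eq,
      Measure.map_map measurableEmbedding_circleEmb.measurable AddCircle.measurable_mk']
    rw [show -π + 2 * π = π by ring]
    congr 1
    funext θ
    exact (circleEmb_coe θ).symm
  refine ⟨κ, ?_, ?_⟩
  · rw [pos_iff_ne_zero]
    intro h0
    rw [h0, zero_smul] at hk
    rw [hk, Measure.map_zero] at hmap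
    have := congrArg (fun μ => μ univ) hmap
    simp at this
    exact hausdorffMeasure_unitSphere_pos.ne this
  · rw [← hmap, hang, ← Measure.map_smul, ← hk]

/-- Arc length on circles: the one-dimensional Hausdorff measure on a circle of radius `R` is a
universal positive multiple of `R` times the angular measure. -/
theorem exists_restrict_sphere_eq_map : ∃ κ : NNReal, 0 < κ ∧
    ∀ (c : E2) (R : NNReal), 0 < R → (μH[1] : Measure E2).restrict (sphere c R) =
      (κ * R) • Measure.map (fun θ => c + (R : ℝ) • angleVec θ) (volume.restrict (Ioc (-π) π)) := by
  obtain ⟨κ, hκ, h⟩ := exists_restrict_unitSphere_eq_map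
  refine ⟨κ, hκ, fun c R hR => ?_⟩
  have hR' : (0 : ℝ) < R := hR
  have hm : Measurable fun x : E2 => c + (R : ℝ) • x := by fun_prop
  have key : (μH[1] : Measure E2).restrict (sphere c R) =
      R • Measure.map (fun x : E2 => c + (R : ℝ) • x)
        ((μH[1] : Measure E2).restrict (sphere 0 1)) := by
    ext A hA
    rw [Measure.restrict_apply hA, Measure.smul_apply, Measure.map_apply hm hA,
      Measure.restrict_apply (hm hA)]
    have himg : A ∩ sphere c R = (IsometryEquiv.addLeft c) ''
        ((R : ℝ) • ((fun x : E2 => c + (R : ℝ) • x) ⁻¹' A ∩ sphere 0 1)) := by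
      ext y
      constructor
      · rintro ⟨hy, hs⟩
        refine ⟨y - c, ⟨(R : ℝ)⁻¹ • (y - c), ⟨?_, ?_⟩, ?_⟩, ?_⟩
        · simpa [smul_smul, hR'.ne'] using hy
        · rw [mem_sphere, dist_eq_norm] at hs
          simp [norm_smul, hs, hR'.ne']
        · simp [smul_smul, hR'.ne']
        · simp
      · rintro ⟨_, ⟨x, ⟨hx, hs⟩, rfl⟩, rfl⟩
        refine ⟨by simpa using hx, ?_⟩
        have : ‖x‖ = 1 := by simpa using hs
        simp [norm_smul, this]
    rw [himg, IsometryEquiv.hausdorffMeasure_image, Measure.hausdorffMeasure_smul₀ zero_le_one hR'.ne']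
    simp
  rw [key, h, Measure.map_smul, Measure.map_map hm continuous_angleVec.measurable, smul_smul,
    mul_comm]
  rfl

/-- The open annulus with centre `c`, inner radius `r` and outer radius `L`. -/
def annulus (c : E2) (r L : ℝ) : Set E2 := ball c L \ closedBall c r

theorem measurableSet_annulus (c : E2) (r L : ℝ) : MeasurableSet (annulus c r L) :=
  measurableSet_ball.diff measurableSet_closedBall

theorem complexToPlane_polarCoord_symm (p : ℝ × ℝ) :
    complexToPlane (Complex.polarCoord.symm p) = p.1 • angleVec p.2 := by
  have h : Complex.polarCoord.symm p = p.1 • (Circle.exp p.2 : ℂ) := by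
    rw [Complex.polarCoord_symm_apply, Circle.coe_exp, Complex.exp_mul_I]
    simp [mul_add]
  rw [h, map_smul, complexToPlane_exp]

theorem setIntegral_annulus (c : E2) {r L : ℝ} (hr : 0 < r) (hrL : r ≤ L) {F : E2 → ℝ}
    (hF : Continuous F) :
    ∫ x in annulus c r L, F x =
      ∫ θ in Ioc (-π) π, ∫ s in r..L, s * F (c + s • angleVec θ) := by
  have hpol : Continuous fun p : ℝ × ℝ => p.1 * F (c + p.1 • angleVec p.2) :=
    continuous_fst.mul (hF.comp (continuous_const.add
      (continuous_fst.smul (continuous_angleVec.comp continuous_snd))))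
  have hmem : ∀ s > 0, ∀ θ, c + s • angleVec θ ∈ annulus c r L ↔ s ∈ Ioo r L := by
    intro s hs θ
    simp [annulus, norm_smul, norm_angleVec, abs_of_pos hs, and_comm]
  calc ∫ x in annulus c r L, F x
      = ∫ x, (annulus c r L).indicator F (c + x) := by
        rw [← integral_indicator (measurableSet_annulus c r L), integral_add_left_eq_self]
    _ = ∫ z : ℂ, (annulus c r L).indicator F (c + complexToPlane z) :=
        (complexToPlane.measurePreserving.integral_comp
          complexToPlane.toHomeomorph.measurableEmbedding
          (fun x => (annulus c r L).indicator F (c + x))).symm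
    _ = ∫ p in Ioo r L ×ˢ Ioc (-π) π, p.1 * F (c + p.1 • angleVec p.2) := by
        rw [← Complex.integral_comp_polarCoord_symm, polarCoord_target]
        have hsub : Ioo r L ×ˢ Ioo (-π) π ⊆ Ioi (0 : ℝ) ×ˢ Ioo (-π) π :=
          prod_mono (fun s hs => hr.trans hs.1) subset_rfl
        have hm : MeasurableSet (Ioo r L ×ˢ Ioo (-π) π) := measurableSet_Ioo.prod measurableSet_Ioo
        have hae : (Ioo r L ×ˢ Ioc (-π) π : Set (ℝ × ℝ)) =ᵐ[volume] Ioo r L ×ˢ Ioo (-π) π :=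
          Measure.set_prod_ae_eq (ae_eq_refl _) Ioo_ae_eq_Ioc.symm
        rw [setIntegral_congr_set hae]
        refine (setIntegral_eq_of_subset_of_forall_sdiff_eq_zero
          (measurableSet_Ioi.prod measurableSet_Ioo) hsub ?_).trans ?_
        · intro p hp
          rw [complexToPlane_polarCoord_symm, indicator_of_notMem, smul_zero]
          intro h
          exact hp.2 ⟨(hmem p.1 hp.1.1 p.2).1 h, hp.1.2⟩
        · refine setIntegral_congr_fun hm fun p hp => ?_
          simp only [complexToPlane_polarCoord_symm, smul_eq_mul]
          rw [indicator_of_mem ((hmem p.1 (hsub hp).1 p.2).2 hp.1)]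
    _ = ∫ θ in Ioc (-π) π, ∫ s in Ioo r L, s * F (c + s • angleVec θ) := by
        rw [Measure.volume_eq_prod, ← Measure.prod_restrict]
        refine integral_prod_symm _ ?_
        rw [Measure.prod_restrict, ← Measure.volume_eq_prod]
        exact (hpol.continuousOn.integrableOn_compact
          (isCompact_Icc.prod isCompact_Icc)).mono_set
          (prod_mono Ioo_subset_Icc_self Ioc_subset_Icc_self)
    _ = _ := by
        simp_rw [intervalIntegral.integral_of_le hrL, integral_Ioc_eq_integral_Ioo]

theorem continuous_radialIntegral (c : E2) (r L : ℝ) {F : E2 → ℝ} (hF : Continuous F) :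
    Continuous fun θ => ∫ s in r..L, s * F (c + s • angleVec θ) := by
  refine intervalIntegral.continuous_parametric_intervalIntegral_of_continuous' ?_ r L
  exact continuous_snd.mul (hF.comp (continuous_const.add
      (continuous_snd.smul (continuous_angleVec.comp continuous_fst))))

/-- A constant relating arc length on circles to the angular measure. -/
structure IsArcConstant (κ : ℝ) : Prop where
  pos : 0 < κ
  setIntegral_sphere : ∀ (c : E2) {R : ℝ}, 0 < R → ∀ {F : E2 → ℝ}, Continuous F →
    ∫ x in sphere c R, F x ∂μH[1] = κ * R * ∫ θ in Ioc (-π) π, F (c + R • angleVec θ)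
  integrableOn_sphere : ∀ (c : E2) {R : ℝ}, 0 < R → ∀ {F : E2 → ℝ}, Continuous F →
    IntegrableOn F (sphere c R) μH[1]

theorem exists_isArcConstant : ∃ κ, IsArcConstant κ := by
  obtain ⟨κ, hκ, h⟩ := exists_restrict_sphere_eq_map
  have hcont : ∀ (c : E2) (R : ℝ), Continuous fun θ => c + R • angleVec θ := fun c R =>
    continuous_const.add (continuous_angleVec.const_smul R)
  refine ⟨κ, hκ, fun c R hR F hF => ?_, fun c R hR F hF => ?_⟩
  · lift R to NNReal using hR.le
    rw [h c R (by exact_mod_cast hR), integral_smul_nnreal_measure,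
      integral_map (hcont c R).aemeasurable hF.aestronglyMeasurable, NNReal.smul_def]
    simp
  · lift R to NNReal using hR.le
    rw [IntegrableOn, h c R (by exact_mod_cast hR)]
    refine Integrable.smul_measure_nnreal ?_
    rw [integrable_map_measure hF.aestronglyMeasurable (hcont c R).aemeasurable]
    exact ((hF.comp (hcont c R)).continuousOn.integrableOn_compact isCompact_Icc).mono_set
      Ioc_subset_Icc_self

/-- For large `β`, the field `g = β * φ` with `φ s = 1 - ((s - r) / (L - r)) ^ 2` satisfies the
Riccati inequality `g' + g / s - g ^ 2 ≥ -(β ^ 2 - c * β)` on `[r, L]`, here divided by `β`. -/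
theorem riccati_inequality {r L c : ℝ} (hr : 0 < r) (hrL : r < L) (hc : c < 1 / r) :
    ∃ β₀ > 0, ∀ β ≥ β₀, ∀ s ∈ Icc r L,
      c ≤ β * (1 - (1 - ((s - r) / (L - r)) ^ 2) ^ 2) - 2 * (s - r) / (L - r) ^ 2 +
        (1 - ((s - r) / (L - r)) ^ 2) / s := by
  have hl : 0 < L - r := sub_pos.2 hrL
  set l := L - r with hl_def
  set K := 2 / l ^ 2 + 1 / r ^ 2 + 1 / (l * r) with hK
  set δ := 1 / r - c with hδ
  have hδ0 : 0 < δ := sub_pos.2 hc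
  have hK0 : 0 < K := by positivity
  refine ⟨K ^ 2 * l ^ 2 / (4 * δ), by positivity, fun β hβ s hs => ?_⟩
  obtain ⟨t, rfl⟩ : ∃ t, s = r + t := ⟨s - r, by ring⟩
  have ht0 : 0 ≤ t := by linarith [hs.1]
  have htl : t ≤ l := by linarith [hs.2]
  rw [show r + t - r = t by ring]
  set y := t / l with hy
  have hy0 : 0 ≤ y := by positivity
  have hy1 : y ≤ 1 := (div_le_one hl).2 htl
  have hβ0 : 0 < β := lt_of_lt_of_le (by positivity) hβ
  have h1 : y ^ 2 ≤ 1 - (1 - y ^ 2) ^ 2 := by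
    nlinarith [mul_nonneg (sq_nonneg y) (sub_nonneg.2 (pow_le_one₀ (n := 2) hy0 hy1))]
  have h2 : 1 / r - t / r ^ 2 - t / (l * r) ≤ (1 - y ^ 2) / (r + t) := by
    have h3 : 1 / r - t / r ^ 2 ≤ 1 / (r + t) := by
      rw [div_sub_div _ _ hr.ne' (by positivity), div_le_div_iff₀ (by positivity) (by positivity)]
      nlinarith [mul_nonneg hr.le (sq_nonneg t)]
    have h4 : y ^ 2 / (r + t) ≤ t / (l * r) := by
      rw [show t / (l * r) = y / r by rw [hy]; field_simp]
      exact div_le_div₀ hy0 (by nlinarith) hr (by linarith)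
    rw [sub_div]
    linarith
  have h5 : β * y ^ 2 ≤ β * (1 - (1 - y ^ 2) ^ 2) := mul_le_mul_of_nonneg_left h1 hβ0.le
  have h6 : K * t ≤ β * y ^ 2 + δ := by
    rw [ge_iff_le, div_le_iff₀ (by positivity)] at hβ
    have hty : t = l * y := by rw [hy]; field_simp
    rw [hty]
    nlinarith [sq_nonneg (K * l * y - 2 * δ), mul_le_mul_of_nonneg_right hβ (sq_nonneg y)]
  have h7 : K * t = 2 * t / l ^ 2 + t / r ^ 2 + t / (l * r) := by rw [hK]; ring
  have h8 : δ = 1 / r - c := hδ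
  linarith

/-- The weighted one-dimensional Robin inequality on a ray. -/
theorem ray_robin_inequality {r L c β : ℝ} (hr : 0 < r) (hrL : r < L) (hβ : 0 < β)
    (hric : ∀ s ∈ Icc r L,
      c ≤ β * (1 - (1 - ((s - r) / (L - r)) ^ 2) ^ 2) - 2 * (s - r) / (L - r) ^ 2 +
        (1 - ((s - r) / (L - r)) ^ 2) / s)
    {f f' N : ℝ → ℝ} (hf : ∀ s, HasDerivAt f (f' s) s) (hf' : Continuous f') (hN : Continuous N)
    (hle : ∀ s, f' s ^ 2 ≤ N s) :
    β * r * f r ^ 2 ≤ ∫ s in r..L, s * (N s + (β ^ 2 - c * β) * f s ^ 2) := by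
  have hl : 0 < L - r := sub_pos.2 hrL
  have hfc : Continuous f := continuous_iff_continuousAt.2 fun s => (hf s).continuousAt
  set φ : ℝ → ℝ := fun s => 1 - ((s - r) / (L - r)) ^ 2 with hφ
  set φ' : ℝ → ℝ := fun s => -(2 * (s - r) / (L - r) ^ 2) with hφ'
  have hφd : ∀ s, HasDerivAt φ (φ' s) s := by
    intro s
    have := ((((hasDerivAt_id s).sub_const r).div_const (L - r)).pow 2).const_sub 1
    refine this.congr_deriv ?_
    simp only [hφ', id]
    norm_num
    field_simp
  have hφc : Continuous φ := by fun_prop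
  have hφ'c : Continuous φ' := by fun_prop
  set G : ℝ → ℝ := fun s => -β * (s * φ s * f s ^ 2) with hG
  set G' : ℝ → ℝ := fun s => -β * ((φ s + s * φ' s) * f s ^ 2 + s * φ s * (2 * f s * f' s)) with hG'
  have hGd : ∀ s, HasDerivAt G (G' s) s := by
    intro s
    have := ((((hasDerivAt_id s).mul (hφd s)).mul ((hf s).pow 2)).const_mul (-β))
    refine this.congr_deriv ?_
    simp [hG']
  have hint : ∫ s in r..L, G' s = β * r * f r ^ 2 := by
    rw [intervalIntegral.integral_eq_sub_of_hasDerivAt (fun s _ => hGd s)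
      (Continuous.intervalIntegrable (by fun_prop) _ _)]
    simp [hG, hφ, hl.ne']
    ring
  rw [← hint]
  refine intervalIntegral.integral_mono_on hrL.le (Continuous.intervalIntegrable (by fun_prop) _ _)
    (Continuous.intervalIntegrable (by fun_prop) _ _) fun s hs => ?_
  have hs0 : 0 < s := hr.trans_le hs.1
  have h1 : c * s ≤ s * (β * (1 - φ s ^ 2)) + s * φ' s + φ s := by
    have := mul_le_mul_of_nonneg_right (hric s hs) hs0.le
    refine this.trans_eq ?_
    simp only [hφ, hφ']
    field_simp
    ring
  have h2 := mul_le_mul_of_nonneg_left (hle s) hs0.le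
  have h3 := mul_le_mul_of_nonneg_right h1 (mul_nonneg hβ.le (sq_nonneg (f s)))
  have h4 := mul_nonneg hs0.le (sq_nonneg (f' s + β * φ s * f s))
  simp only [hG']
  nlinarith

theorem annulus_robin_inequality {κ : ℝ} (hκ : IsArcConstant κ) {r L c β : ℝ} (hr : 0 < r)
    (hrL : r < L) (hβ : 0 < β)
    (hric : ∀ s ∈ Icc r L,
      c ≤ β * (1 - (1 - ((s - r) / (L - r)) ^ 2) ^ 2) - 2 * (s - r) / (L - r) ^ 2 +
        (1 - ((s - r) / (L - r)) ^ 2) / s)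
    (x : E2) {u : E2 → ℝ} (hu : ContDiff ℝ (⊤ : ℕ∞) u) :
    β / κ * ∫ y in sphere x r, u y ^ 2 ∂μH[1] ≤
      ∫ y in annulus x r L, (‖fderiv ℝ u y‖ ^ 2 + (β ^ 2 - c * β) * u y ^ 2) := by
  have hκ0 := hκ.pos
  have huc := hu.continuous
  have hdc : Continuous (fderiv ℝ u) := hu.continuous_fderiv (by simp)
  have hF : Continuous fun y => ‖fderiv ℝ u y‖ ^ 2 + (β ^ 2 - c * β) * u y ^ 2 := by fun_prop
  have hray : ∀ θ, Continuous fun s : ℝ => x + s • angleVec θ := fun θ => by fun_prop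
  rw [setIntegral_annulus x hr hrL.le hF, hκ.setIntegral_sphere x hr (by fun_prop),
    show ∀ I : ℝ, β / κ * (κ * r * I) = β * r * I by intro I; field_simp, ← integral_const_mul]
  refine setIntegral_mono_on ?_ ?_ measurableSet_Ioc fun θ _ => ?_
  · refine (Continuous.continuousOn ?_).integrableOn_compact isCompact_Icc |>.mono_set
      Ioc_subset_Icc_self
    exact continuous_const.mul ((huc.comp (continuous_const.add
      (continuous_angleVec.const_smul r))).pow 2)
  · exact ((continuous_radialIntegral x r L hF).continuousOn.integrableOn_compact
      isCompact_Icc).mono_set Ioc_subset_Icc_self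
  · refine ray_robin_inequality (f := fun s => u (x + s • angleVec θ))
      (f' := fun s => fderiv ℝ u (x + s • angleVec θ) (angleVec θ))
      (N := fun s => ‖fderiv ℝ u (x + s • angleVec θ)‖ ^ 2) hr hrL hβ hric
      (fun s => ?_) ?_ ?_ fun s => ?_
    · have h1 : HasDerivAt (fun s : ℝ => x + s • angleVec θ) (angleVec θ) s := by
        simpa using ((hasDerivAt_id s).smul_const (angleVec θ)).const_add x
      exact ((hu.differentiable (by simp)) _).hasFDerivAt.comp_hasDerivAt s h1
    · exact (hdc.comp (hray θ)).clm_apply continuous_const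
    · exact (hdc.comp (hray θ)).norm.pow 2
    · rw [← sq_abs, ← Real.norm_eq_abs]
      gcongr
      simpa [norm_angleVec] using (fderiv ℝ u (x + s • angleVec θ)).le_opNorm (angleVec θ)

theorem integrable_sq_norm_fderiv {u : E2 → ℝ} (hu : ContDiff ℝ (⊤ : ℕ∞) u)
    (hs : HasCompactSupport u) : Integrable fun y => ‖fderiv ℝ u y‖ ^ 2 := by
  refine Continuous.integrable_of_hasCompactSupport ?_ ?_
  · exact (hu.continuous_fderiv (by simp)).norm.pow 2
  · exact (hs.fderiv ℝ).comp_left (g := fun A => ‖A‖ ^ 2) (by simp)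

theorem integrable_sq {u : E2 → ℝ} (hu : ContDiff ℝ (⊤ : ℕ∞) u)
    (hs : HasCompactSupport u) : Integrable fun y => u y ^ 2 :=
  Continuous.integrable_of_hasCompactSupport (hu.continuous.pow 2)
    (hs.comp_left (g := fun t : ℝ => t ^ 2) (by simp))

theorem measurableSet_extDom (Ω : Set E2) : MeasurableSet (extDom Ω) :=
  isClosed_closure.isOpen_compl.measurableSet

theorem setIntegral_iUnion_sphere_le {κ : ℝ} (hκ : IsArcConstant κ) {ι : Type*} [Fintype ι]
    (x : ι → E2) {r : ℝ} (hr : 0 < r) {F : E2 → ℝ} (hF : Continuous F) (hF0 : ∀ y, 0 ≤ F y)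
    {S : Set E2} (hS : S ⊆ ⋃ i, sphere (x i) r) :
    ∫ y in S, F y ∂μH[1] ≤ ∑ i, ∫ y in sphere (x i) r, F y ∂μH[1] := by
  have hi : ∀ i ∈ Finset.univ, Integrable F ((μH[1] : Measure E2).restrict (sphere (x i) r)) :=
    fun i _ => hκ.integrableOn_sphere (x i) hr hF
  rw [← integral_finsetSum_measure hi]
  refine integral_mono_measure ?_ (ae_of_all _ hF0) (integrable_finsetSum_measure.2 hi)
  rw [← Measure.sum_fintype]
  exact (Measure.restrict_mono hS le_rfl).trans Measure.restrict_iUnion_le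

/-- A lower bound for all Rayleigh quotients in the exterior of a set bounded by circles of radius
`r` surrounded by disjoint annuli. -/
theorem le_rayleigh {κ : ℝ} (hκ : IsArcConstant κ) {r L c β : ℝ} (hr : 0 < r)
    (hrL : r < L) (hβ : 0 < β) (hcβ : c ≤ β)
    (hric : ∀ s ∈ Icc r L,
      c ≤ β * (1 - (1 - ((s - r) / (L - r)) ^ 2) ^ 2) - 2 * (s - r) / (L - r) ^ 2 +
        (1 - ((s - r) / (L - r)) ^ 2) / s)
    {ι : Type*} [Fintype ι] (x : ι → E2) {Ω : Set E2} (hfr : frontier Ω ⊆ ⋃ i, sphere (x i) r)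
    (hext : ∀ i, annulus (x i) r L ⊆ extDom Ω)
    (hdisj : Pairwise fun i j => Disjoint (annulus (x i) r L) (annulus (x j) r L))
    {u : E2 → ℝ} (hu : ContDiff ℝ (⊤ : ℕ∞) u) (hs : HasCompactSupport u) :
    -(β ^ 2 - c * β) ≤ ((∫ x in extDom Ω, ‖fderiv ℝ u x‖ ^ 2) +
          -(β / κ) * ∫ x in frontier Ω, (u x) ^ 2 ∂(μH[1])) /
        (∫ x in extDom Ω, (u x) ^ 2) := by
  have hM : 0 ≤ β ^ 2 - c * β := by nlinarith
  have hden : 0 ≤ ∫ x in extDom Ω, (u x) ^ 2 := integral_nonneg fun _ => sq_nonneg _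
  have hgi := integrable_sq_norm_fderiv hu hs
  have hui := integrable_sq hu hs
  have hGi : Integrable fun y => ‖fderiv ℝ u y‖ ^ 2 + (β ^ 2 - c * β) * u y ^ 2 :=
    hgi.add (hui.const_mul _)
  have hann : ∑ i, ∫ y in annulus (x i) r L, (‖fderiv ℝ u y‖ ^ 2 + (β ^ 2 - c * β) * u y ^ 2) ≤
      ∫ y in extDom Ω, (‖fderiv ℝ u y‖ ^ 2 + (β ^ 2 - c * β) * u y ^ 2) := by
    rw [← integral_iUnion_fintype (fun i => measurableSet_annulus (x i) r L) hdisj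
      fun i => hGi.integrableOn]
    exact setIntegral_mono_set hGi.integrableOn (ae_of_all _ fun y => by positivity)
      (iUnion_subset hext).eventuallyLE
  have hbd := mul_le_mul_of_nonneg_left (setIntegral_iUnion_sphere_le hκ x hr
    (F := fun y => u y ^ 2) (hu.continuous.pow 2) (fun y => sq_nonneg (u y)) hfr) (div_pos hβ hκ.pos).le
  rw [Finset.mul_sum] at hbd
  have hsum := Finset.sum_le_sum fun i (_ : i ∈ Finset.univ) =>
    annulus_robin_inequality hκ hr hrL hβ hric (x i) hu
  rw [integral_add hgi.integrableOn (hui.const_mul _).integrableOn, integral_const_mul] at hann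
  rcases hden.eq_or_lt with h0 | h0
  · rw [← h0, div_zero]
    linarith
  · rw [le_div_iff₀ h0]
    linarith

/-- A lower bound for the Robin eigenvalue at strong coupling, which moreover guarantees that its
defining set is bounded below. -/
theorem exists_le_rayleigh {κ : ℝ} (hκ : IsArcConstant κ) {r L c : ℝ} (hr : 0 < r)
    (hrL : r < L) (hc : c < 1 / r)
    {ι : Type*} [Fintype ι] (x : ι → E2) {Ω : Set E2} (hfr : frontier Ω ⊆ ⋃ i, sphere (x i) r)
    (hext : ∀ i, annulus (x i) r L ⊆ extDom Ω)
    (hdisj : Pairwise fun i j => Disjoint (annulus (x i) r L) (annulus (x j) r L)) :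
    ∃ β₀ > 0, ∀ β ≥ β₀, c ≤ β ∧
      ∀ u : E2 → ℝ, ContDiff ℝ (⊤ : ℕ∞) u → HasCompactSupport u →
      -(β ^ 2 - c * β) ≤ ((∫ x in extDom Ω, ‖fderiv ℝ u x‖ ^ 2) +
          -(β / κ) * ∫ x in frontier Ω, (u x) ^ 2 ∂(μH[1])) /
        (∫ x in extDom Ω, (u x) ^ 2) := by
  obtain ⟨β₀, hβ₀, h⟩ := riccati_inequality hr hrL hc
  refine ⟨max β₀ c, lt_max_of_lt_left hβ₀, fun β hβ => ⟨(le_max_right _ _).trans hβ, ?_⟩⟩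
  have hβ' := (le_max_left _ _).trans hβ
  exact fun u hu hs => le_rayleigh hκ hr hrL (hβ₀.trans_le hβ') ((le_max_right _ _).trans hβ)
    (h β hβ') x hfr hext hdisj hu hs

/-- Smooth cutoffs on the line with small derivative. -/
theorem exists_slow_cutoff (a : ℝ) {ε : ℝ} (hε : 0 < ε) :
    ∃ N > 0, ∃ χ : ℝ → ℝ, ContDiff ℝ (⊤ : ℕ∞) χ ∧ χ a = 1 ∧ (∀ w, 0 ≤ χ w ∧ χ w ≤ 1) ∧
      (∀ w ≥ a + N, χ w = 0) ∧ 0 < χ (a + 1 / 2) ∧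
      ∀ w ∈ Icc a (a + N + 1), |deriv χ w| ≤ ε := by
  have hsm : ContDiff ℝ (⊤ : ℕ∞) smoothTransition := smoothTransition.contDiff
  obtain ⟨C, hC⟩ := (isCompact_Icc (a := (-1 : ℝ)) (b := 1)).exists_bound_of_continuousOn
    (hsm.continuous_deriv (by simp)).continuousOn
  have hC0 : 0 ≤ C := (norm_nonneg _).trans (hC 0 (by simp))
  set N := C / ε + 1 with hN
  have hN1 : 1 ≤ N := le_add_of_nonneg_left (by positivity)
  have hN0 : 0 < N := by linarith
  refine ⟨N, hN0, fun w => smoothTransition (1 + (a - w) / N), ?_, ?_,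
    fun w => ⟨smoothTransition.nonneg _, smoothTransition.le_one _⟩, fun w hw => ?_, ?_,
    fun w hw => ?_⟩
  · exact hsm.comp (by fun_prop)
  · simp
  · refine smoothTransition.zero_of_nonpos ?_
    have : (a - w) / N ≤ -1 := by rw [div_le_iff₀ hN0]; linarith
    linarith
  · refine smoothTransition.pos_of_pos ?_
    have : -1 < (a - (a + 1 / 2)) / N := by rw [lt_div_iff₀ hN0]; linarith
    linarith
  · have hin : HasDerivAt (fun w => 1 + (a - w) / N) (-1 / N) w :=
      (((hasDerivAt_id w).const_sub a).div_const N).const_add 1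
    have hout := ((hsm.differentiable (by simp)) (1 + (a - w) / N)).hasDerivAt
    have hcomp := (hout.comp w hin).deriv
    rw [Function.comp_def] at hcomp
    rw [hcomp, abs_mul]
    have h1 : -2 ≤ (a - w) / N := by rw [le_div_iff₀ hN0]; linarith [hw.2]
    have h2 : (a - w) / N ≤ 0 := div_nonpos_of_nonpos_of_nonneg (by linarith [hw.1]) hN0.le
    have h3 := hC (1 + (a - w) / N) ⟨by linarith, by linarith⟩
    rw [Real.norm_eq_abs] at h3
    rw [abs_div, abs_neg, abs_one, abs_of_pos hN0, mul_one_div, div_le_iff₀ hN0, hN]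
    refine h3.trans ?_
    rw [mul_add, mul_div_cancel₀ _ hε.ne']
    linarith

theorem gaussian_ray_integral_le {R L A B b : ℝ} (hb : 0 < b) (hA : 0 ≤ A) (hB : 0 ≤ B) :
    ∫ s in R..L, s * ((A * s ^ 2 + B) * rexp (-(2 * b * (s ^ 2 - R ^ 2)))) ≤
      A * R ^ 2 / (4 * b) + A / (8 * b ^ 2) + B / (4 * b) := by
  set P : ℝ → ℝ := fun s =>
    -((A * s ^ 2 / (4 * b) + A / (8 * b ^ 2) + B / (4 * b)) * rexp (-(2 * b * (s ^ 2 - R ^ 2))))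
    with hP
  have hd : ∀ s, HasDerivAt P (s * ((A * s ^ 2 + B) * rexp (-(2 * b * (s ^ 2 - R ^ 2))))) s := by
    intro s
    have h1 : HasDerivAt (fun s : ℝ => s ^ 2) (2 * s) s := by simpa using hasDerivAt_pow 2 s
    have h2 := ((((h1.const_mul A).div_const (4 * b)).add_const (A / (8 * b ^ 2))).add_const
      (B / (4 * b))).mul ((h1.sub_const (R ^ 2)).const_mul (2 * b)).neg.exp
    refine h2.neg.congr_deriv ?_
    simp only [Pi.neg_apply]
    field_simp
    ring
  rw [intervalIntegral.integral_eq_sub_of_hasDerivAt (fun s _ => hd s)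
    (Continuous.intervalIntegrable (by fun_prop) _ _)]
  have hL : P L ≤ 0 := neg_nonpos.2 (by positivity)
  have hR : P R = -(A * R ^ 2 / (4 * b) + A / (8 * b ^ 2) + B / (4 * b)) := by simp [hP]
  linarith

theorem norm_fderiv_radial_le (c : E2) {h : ℝ → ℝ} (hh : Differentiable ℝ h) (x : E2) :
    ‖fderiv ℝ (fun x => h (‖x - c‖ ^ 2)) x‖ ≤ |deriv h (‖x - c‖ ^ 2)| * (2 * ‖x - c‖) := by
  have h1 : HasFDerivAt (fun x => ‖x - c‖ ^ 2) (2 • (innerSL ℝ (x - c)).comp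
      (ContinuousLinearMap.id ℝ E2)) x := ((hasFDerivAt_id x).sub_const c).norm_sq
  have h2 := (hh (‖x - c‖ ^ 2)).hasDerivAt.comp_hasFDerivAt x h1
  have h3 : fderiv ℝ (fun x => h (‖x - c‖ ^ 2)) x = _ := h2.fderiv
  rw [h3, norm_smul, Real.norm_eq_abs]
  gcongr
  refine ContinuousLinearMap.opNorm_le_bound _ (by positivity) fun v => ?_
  have := norm_inner_le_norm (𝕜 := ℝ) (x - c) v
  simp only [ContinuousLinearMap.comp_id, smul_apply, innerSL_apply_apply,
    nsmul_eq_mul, norm_mul]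
  norm_num
  rw [Real.norm_eq_abs] at this
  linarith

theorem extDom_ball (c : E2) {R : ℝ} (hR : 0 < R) : extDom (ball c R) = (closedBall c R)ᶜ := by
  rw [extDom, closure_ball c hR.ne']

/-- A truncated Gaussian shows that the Robin eigenvalue of the exterior of a disk of radius `R`
is at most `-β ^ 2 + c * β` for every `c > 1 / R`. -/
theorem exists_rayleigh_lt {κ : ℝ} (hκ : IsArcConstant κ) {R c' β : ℝ} (hR : 0 < R)
    (hc' : 1 / R < c') (hβ : 0 < β) (hcβ : c' ≤ β) (c : E2) :
    ∃ u : E2 → ℝ, ContDiff ℝ (⊤ : ℕ∞) u ∧ HasCompactSupport u ∧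
      (∃ x ∈ extDom (ball c R), u x ≠ 0) ∧
      ((∫ x in extDom (ball c R), ‖fderiv ℝ u x‖ ^ 2) +
          -(β / κ) * ∫ x in frontier (ball c R), (u x) ^ 2 ∂(μH[1])) /
        (∫ x in extDom (ball c R), (u x) ^ 2) < -(β ^ 2 - c' * β) := by
  have hκ0 := hκ.pos
  set M := β ^ 2 - c' * β with hM
  have hM0 : 0 ≤ M := by nlinarith
  set b := β / (2 * R) with hb
  have hb0 : 0 < b := by positivity
  set p := β * R / 2 + 1 / 2 with hp
  set q := β * R / 2 + c' * R / 2 with hq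
  have hp0 : 0 < p := by positivity
  have hpq : p < q := by
    rw [div_lt_iff₀ hR] at hc'
    linarith
  obtain ⟨δ, hδ0, hδ1, hδ⟩ : ∃ δ > 0, δ ≤ 1 ∧ 3 * δ * p < q - p := by
    refine ⟨min 1 ((q - p) / (4 * p)), lt_min one_pos (div_pos (by linarith) (by positivity)),
      min_le_left _ _, ?_⟩
    have := min_le_right 1 ((q - p) / (4 * p))
    rw [le_div_iff₀ (by positivity)] at this
    linarith
  set A := 4 * (b * (1 + δ)) ^ 2 with hA
  have hV : A * R ^ 2 / (4 * b) + A / (8 * b ^ 2) + M / (4 * b) < β * R := by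
    have h1 : A * R ^ 2 / (4 * b) + A / (8 * b ^ 2) + M / (4 * b) =
        (1 + δ) ^ 2 * p + (β - c') * R / 2 := by
      rw [hA, hb, hp, hM]
      field_simp
      ring
    have h2 : (1 + δ) ^ 2 * p ≤ (1 + 3 * δ) * p :=
      mul_le_mul_of_nonneg_right (by nlinarith) hp0.le
    rw [h1]
    linarith
  obtain ⟨N, hN, χ, hχs, hχ1, hχb, hχ0, hχp, hχd⟩ :=
    exists_slow_cutoff (R ^ 2) (ε := b * δ) (by positivity)
  set h : ℝ → ℝ := fun w => rexp (-(b * (w - R ^ 2))) * χ w with hh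
  have hhs : ContDiff ℝ (⊤ : ℕ∞) h := ContDiff.mul (by fun_prop) hχs
  have hhd : ∀ w ∈ Icc (R ^ 2) (R ^ 2 + N + 1),
      |deriv h w| ≤ rexp (-(b * (w - R ^ 2))) * (b * (1 + δ)) := by
    intro w hw
    have h1 : HasDerivAt (fun w => rexp (-(b * (w - R ^ 2))))
        (rexp (-(b * (w - R ^ 2))) * -(b * 1)) w :=
      (((hasDerivAt_id w).sub_const (R ^ 2)).const_mul b).neg.exp
    have h2 := h1.mul ((hχs.differentiable (by simp)) w).hasDerivAt
    rw [show deriv h w = _ from h2.deriv, mul_assoc, ← mul_add, abs_mul, abs_of_pos (exp_pos _)]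
    gcongr
    refine (abs_add_le _ _).trans ?_
    rw [abs_mul, abs_of_nonneg (hχb w).1, mul_one, abs_neg, abs_of_pos hb0]
    nlinarith [hχd w hw, (hχb w).2]
  set u : E2 → ℝ := fun x => h (‖x - c‖ ^ 2) with hu
  have hus : ContDiff ℝ (⊤ : ℕ∞) u := hhs.comp ((contDiff_id.sub contDiff_const).norm_sq ℝ)
  set L₀ := √(R ^ 2 + N) with hL₀
  set L := √(R ^ 2 + N + 1) with hL
  have hL₀L : L₀ < L := sqrt_lt_sqrt (by positivity) (by linarith)
  have hRL : R < L := lt_sqrt_of_sq_lt (by linarith)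
  have hL2 : L ^ 2 = R ^ 2 + N + 1 := sq_sqrt (by positivity)
  have hL₀2 : L₀ ^ 2 = R ^ 2 + N := sq_sqrt (by positivity)
  have hu0 : ∀ x ∉ closedBall c L₀, u x = 0 := by
    intro x hx
    rw [mem_closedBall, dist_eq_norm, not_le] at hx
    have : R ^ 2 + N ≤ ‖x - c‖ ^ 2 := by
      rw [← hL₀2]
      exact pow_le_pow_left₀ (sqrt_nonneg _) hx.le 2
    simp [hu, hh, hχ0 _ this]
  have hts : tsupport u ⊆ closedBall c L₀ :=
    closure_minimal (fun x hx => by_contra fun hn => hx (hu0 x hn)) isClosed_closedBall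
  have huc : HasCompactSupport u := HasCompactSupport.intro (isCompact_closedBall c L₀) hu0
  have hne : ∃ x ∈ extDom (ball c R), u x ≠ 0 := by
    refine ⟨c + √(R ^ 2 + 1 / 2) • angleVec 0, ?_, ?_⟩
    · rw [extDom_ball c hR]
      have : R < √(R ^ 2 + 1 / 2) := lt_sqrt_of_sq_lt (by linarith)
      simpa [norm_smul, norm_angleVec, abs_of_nonneg (sqrt_nonneg _)] using this
    · have : 0 < R ^ 2 + 1 / 2 := by positivity
      simp only [hu, hh, add_sub_cancel_left, norm_smul, norm_angleVec, mul_one, Real.norm_eq_abs,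
        sq_abs, sq_sqrt this.le]
      exact (mul_pos (exp_pos _) hχp).ne'
  refine ⟨u, hus, huc, hne, ?_⟩
  have hden : 0 < ∫ x in extDom (ball c R), (u x) ^ 2 := by
    rw [setIntegral_pos_iff_support_of_nonneg_ae (ae_of_all _ fun x => sq_nonneg _)
      (integrable_sq hus huc).integrableOn]
    obtain ⟨x, hx, hux⟩ := hne
    exact (((hus.continuous.pow 2).isOpen_support).inter
      isClosed_closure.isOpen_compl).measure_pos _ ⟨x, by simpa using hux, hx⟩
  have hvol : volume.real (Ioc (-π) π) = 2 * π := by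
    rw [Real.volume_real_Ioc_of_le (by linarith [pi_pos])]
    ring
  have hfr : ∫ x in frontier (ball c R), (u x) ^ 2 ∂(μH[1]) = κ * R * (2 * π) := by
    rw [frontier_ball c hR.ne', hκ.setIntegral_sphere c hR (F := fun x => u x ^ 2) (hus.continuous.pow 2)]
    congr 1
    have : ∀ θ, u (c + R • angleVec θ) ^ 2 = 1 := by
      intro θ
      simp [hu, hh, norm_smul, norm_angleVec, hχ1]
    simp_rw [this]
    rw [setIntegral_const, hvol, smul_eq_mul, mul_one]
  have hgi := integrable_sq_norm_fderiv hus huc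
  have hui := integrable_sq hus huc
  have hF : Continuous fun x => ‖fderiv ℝ u x‖ ^ 2 + M * u x ^ 2 := by
    have := hus.continuous_fderiv (by simp)
    have := hus.continuous
    fun_prop
  have hsum : (∫ x in extDom (ball c R), ‖fderiv ℝ u x‖ ^ 2) +
      M * (∫ x in extDom (ball c R), (u x) ^ 2) =
      ∫ x in annulus c R L, (‖fderiv ℝ u x‖ ^ 2 + M * u x ^ 2) := by
    rw [← integral_const_mul, ← integral_add hgi.integrableOn (hui.const_mul _).integrableOn]
    refine setIntegral_eq_of_subset_of_forall_sdiff_eq_zero (measurableSet_extDom _) ?_ ?_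
    · rw [extDom_ball c hR]
      exact fun x hx => hx.2
    · rintro x ⟨hx, hxn⟩
      rw [extDom_ball c hR] at hx
      have hxL : x ∉ closedBall c L₀ := fun hn => hxn ⟨closedBall_subset_ball hL₀L hn, hx⟩
      have h1 : fderiv ℝ u x = 0 :=
        Function.notMem_support.1 fun hn => hxL (hts (support_fderiv_subset ℝ hn))
      simp [h1, hu0 x hxL]
  have hann : ∫ x in annulus c R L, (‖fderiv ℝ u x‖ ^ 2 + M * u x ^ 2) ≤
      (A * R ^ 2 / (4 * b) + A / (8 * b ^ 2) + M / (4 * b)) * (2 * π) := by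
    rw [setIntegral_annulus c hR hRL.le hF]
    have hconst : ∫ _ in Ioc (-π) π,
        (A * R ^ 2 / (4 * b) + A / (8 * b ^ 2) + M / (4 * b)) =
        (A * R ^ 2 / (4 * b) + A / (8 * b ^ 2) + M / (4 * b)) * (2 * π) := by
      rw [setIntegral_const, hvol, smul_eq_mul, mul_comm]
    rw [← hconst]
    refine setIntegral_mono_on ?_ ?_ measurableSet_Ioc fun θ _ => ?_
    · exact ((continuous_radialIntegral c R L hF).continuousOn.integrableOn_compact
        isCompact_Icc).mono_set Ioc_subset_Icc_self
    · exact integrableOn_const (by simp)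
    refine le_trans ?_ (gaussian_ray_integral_le (R := R) (L := L) hb0 (by positivity) hM0)
    refine intervalIntegral.integral_mono_on hRL.le (Continuous.intervalIntegrable ?_ _ _)
      (Continuous.intervalIntegrable (by fun_prop) _ _) fun s hs => ?_
    · exact continuous_id.mul (hF.comp (by fun_prop))
    have hs0 : 0 < s := hR.trans_le hs.1
    have hnorm : ‖c + s • angleVec θ - c‖ = s := by
      simp [norm_smul, norm_angleVec, hs0.le]
    have hsI : s ^ 2 ∈ Icc (R ^ 2) (R ^ 2 + N + 1) := by
      rw [← hL2]
      exact ⟨pow_le_pow_left₀ hR.le hs.1 2, pow_le_pow_left₀ hs0.le hs.2 2⟩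
    have hE : rexp (-(2 * b * (s ^ 2 - R ^ 2))) = rexp (-(b * (s ^ 2 - R ^ 2))) ^ 2 := by
      rw [← exp_nat_mul]
      congr 1
      push_cast
      ring
    have h1 : ‖fderiv ℝ u (c + s • angleVec θ)‖ ≤
        rexp (-(b * (s ^ 2 - R ^ 2))) * (b * (1 + δ)) * (2 * s) := by
      have := norm_fderiv_radial_le c (hhs.differentiable (by simp)) (c + s • angleVec θ)
      rw [hnorm] at this
      exact this.trans (mul_le_mul_of_nonneg_right (hhd _ hsI) (by positivity))
    have h2 : u (c + s • angleVec θ) ^ 2 ≤ rexp (-(b * (s ^ 2 - R ^ 2))) ^ 2 := by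
      simp only [hu, hh, hnorm, mul_pow]
      exact mul_le_of_le_one_right (by positivity) (pow_le_one₀ (hχb _).1 (hχb _).2)
    have h3 := pow_le_pow_left₀ (norm_nonneg _) h1 2
    have h4 := mul_le_mul_of_nonneg_left h2 hM0
    refine mul_le_mul_of_nonneg_left ?_ hs0.le
    rw [hE, hA]
    linarith
  rw [div_lt_iff₀ hden, hfr, show -(β / κ) * (κ * R * (2 * π)) = -(β * R) * (2 * π) by field_simp]
  have := mul_lt_mul_of_pos_right hV two_pi_pos
  linarith

theorem annulus_subset_extDom_ball (c : E2) {R : ℝ} (hR : 0 < R) (L : ℝ) :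
    annulus c R L ⊆ extDom (ball c R) := by
  rw [extDom_ball c hR]
  exact fun x hx => hx.2

theorem frontier_union_balls_subset (x : Fin 2 → E2) (r : ℝ) :
    frontier (ball (x 0) r ∪ ball (x 1) r) ⊆ ⋃ i, sphere (x i) r := by
  intro y hy
  rcases frontier_union_subset _ _ hy with h | h
  · exact mem_iUnion.2 ⟨0, frontier_ball_subset_sphere h.1⟩
  · exact mem_iUnion.2 ⟨1, frontier_ball_subset_sphere h.2⟩

theorem annulus_subset_extDom_union {x₁ x₂ : E2} {r : ℝ} (hr : 0 < r)
    (hsep : 2 * r < dist x₁ x₂) :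
    annulus x₁ r (dist x₁ x₂ / 2) ⊆ extDom (ball x₁ r ∪ ball x₂ r) := by
  intro y hy hy'
  rw [closure_union, closure_ball _ hr.ne', closure_ball _ hr.ne'] at hy'
  rcases hy' with h | h
  · exact hy.2 h
  · have h1 := hy.1
    rw [mem_ball] at h1
    rw [mem_closedBall] at h
    linarith [dist_triangle_left x₁ x₂ y]

/-- Failure of the reverse isochoric inequality without convexity: for the union of
two disjoint disks, the disk of equal area gives a strictly smaller exterior
eigenvalue in the strong coupling regime. -/
theorem nonconvex_counterexample_area
    (r : ℝ) (hr : 0 < r) (x₁ x₂ c : E2) (hsep : 2 * r < dist x₁ x₂) :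
    ∃ α₀ < (0:ℝ), ∀ α < α₀,
      robinEig α (ball c (Real.sqrt 2 * r)) < robinEig α (ball x₁ r ∪ ball x₂ r) := by
  obtain ⟨κ, hκ⟩ := exists_isArcConstant
  have hκ0 := hκ.pos
  set R := √2 * r with hR_def
  have h2 : 1 < √2 := lt_sqrt_of_sq_lt (by norm_num)
  have hR : 0 < R := by positivity
  have hrR : r < R := by nlinarith
  obtain ⟨c₁, hRc, hcr⟩ := exists_between (one_div_lt_one_div_of_lt hr hrR)
  set x : Fin 2 → E2 := ![x₁, x₂] with hx
  obtain ⟨β₁, hβ₁, hlow⟩ := exists_le_rayleigh (c := c₁) (L := dist x₁ x₂ / 2) hκ hr (by linarith)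
    hcr x (frontier_union_balls_subset x r)
    (fun i => by
      fin_cases i
      · exact annulus_subset_extDom_union hr hsep
      · have h := annulus_subset_extDom_union hr (dist_comm x₁ x₂ ▸ hsep)
        rw [dist_comm, union_comm] at h
        exact h)
    (by
      have hd : Disjoint (annulus x₁ r (dist x₁ x₂ / 2)) (annulus x₂ r (dist x₁ x₂ / 2)) :=
        (ball_disjoint_ball (by linarith)).mono sdiff_subset sdiff_subset
      intro i j hij
      fin_cases i <;> fin_cases j
      · exact absurd rfl hij
      · exact hd
      · exact hd.symm
      · exact absurd rfl hij)
  obtain ⟨β₂, hβ₂, hbdd⟩ := exists_le_rayleigh (c := 0) (L := 2 * R) hκ hR (by linarith)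
    (by positivity) (fun _ : Unit => c) (Ω := ball c R)
    (by rw [iUnion_const]; exact frontier_ball_subset_sphere)
    (fun _ => annulus_subset_extDom_ball c hR _) (fun i j hij => absurd rfl hij)
  refine ⟨-(max β₁ β₂ / κ), neg_neg_of_pos (div_pos (lt_max_of_lt_left hβ₁) hκ0), fun α hα => ?_⟩
  obtain ⟨β, rfl⟩ : ∃ β, α = -(β / κ) := ⟨-(α * κ), by field_simp⟩
  have hβ : max β₁ β₂ < β := by
    rwa [neg_lt_neg_iff, div_lt_div_iff_of_pos_right hκ0] at hα
  obtain ⟨hcβ, hlow⟩ := hlow β ((le_max_left _ _).trans hβ.le)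
  obtain ⟨-, hbdd⟩ := hbdd β ((le_max_right _ _).trans hβ.le)
  have hβ0 : 0 < β := (lt_max_of_lt_left hβ₁).trans hβ
  obtain ⟨c₂, hRc₂, hc₂⟩ := exists_between hRc
  obtain ⟨u, hus, huc, hne, hq⟩ := exists_rayleigh_lt hκ hR hRc₂ hβ0 (hc₂.le.trans hcβ) c
  have hupper : robinEig (-(β / κ)) (ball c R) < -(β ^ 2 - c₂ * β) := by
    refine lt_of_le_of_lt (csInf_le ⟨-(β ^ 2 - 0 * β), ?_⟩ ⟨u, hus, huc, hne, rfl⟩) hq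
    rintro _ ⟨v, hvs, hvc, -, rfl⟩
    exact hbdd v hvs hvc
  have hlower : -(β ^ 2 - c₁ * β) ≤ robinEig (-(β / κ)) (ball x₁ r ∪ ball x₂ r) := by
    refine Real.le_sInf ?_ (by nlinarith)
    rintro _ ⟨v, hvs, hvc, -, rfl⟩
    exact hlow v hvs hvc
  have : c₂ * β < c₁ * β := mul_lt_mul_of_pos_right hc₂ hβ0
  linarith

end
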